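/- Let d ≥ 1 be an integer, α ∈ (0,2) and r_1 ∈ (0, 1/2]. Then there exist δ ∈ (0, r_1/4] and a constant C > 0, depending only on α, d and r_1, such that for every y ∈ V_δ the limit defining the truncated fractional Laplacian Δ̂^{α/2} h_α(y) exists and |Δ̂^{α/2} h_α(y)| ≤ C · |log( y_d − √(r_1² − |ỹ|²) )|. -/

import Mathlib

open MeasureTheory Filter Set

/-- The constant 𝒜(d, -α) = α 2^{α-1} π^{-d/2} Γ((d+α)/2) Γ(1-α/2)^{-1}. -/
noncomputable def fracConst (d : ℕ) (α : ℝ) : ℝ :=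
  α * 2 ^ (α - 1) * Real.pi ^ (-(d : ℝ) / 2) *
    Real.Gamma (((d : ℝ) + α) / 2) / Real.Gamma (1 - α / 2)

/-- The Euclidean norm on ℝ^{m} × ℝ ≅ ℝ^{m+1}, writing y = (ỹ, y_d). -/
noncomputable def enorm' {m : ℕ} (y : EuclideanSpace ℝ (Fin m) × ℝ) : ℝ :=
  Real.sqrt (‖y.1‖ ^ 2 + y.2 ^ 2)

/-- The truncated integral ∫_{ε<|y-x|≤1} (u(y)-u(x)) |x-y|^{-d-α} dy on
ℝ^{d-1} × ℝ ≅ ℝ^d, whose limit as ε ↓ 0 defines the truncated fractional Laplacian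
Δ̂^{α/2}u(x) (up to the constant `fracConst d α`). -/
noncomputable def pvInt2Tr (d : ℕ) (α : ℝ)
    (u : EuclideanSpace ℝ (Fin (d - 1)) × ℝ → ℝ)
    (x : EuclideanSpace ℝ (Fin (d - 1)) × ℝ) (ε : ℝ) : ℝ :=
  ∫ y in {y : EuclideanSpace ℝ (Fin (d - 1)) × ℝ |
      ε < enorm' (y - x) ∧ enorm' (y - x) ≤ 1},
    (u y - u x) / enorm' (x - y) ^ ((d : ℝ) + α)

/-- h_p(y) = (y_d - √(r₁² - |ỹ|²))^p on {r₁ < |y| < 3r₁/2, y_d > 0, |ỹ| < r₁/2},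
and 0 otherwise. -/
noncomputable def hfun (d : ℕ) (r1 p : ℝ)
    (y : EuclideanSpace ℝ (Fin (d - 1)) × ℝ) : ℝ :=
  if r1 < enorm' y ∧ enorm' y < 3 * r1 / 2 ∧ 0 < y.2 ∧ ‖y.1‖ < r1 / 2 then
    (y.2 - Real.sqrt (r1 ^ 2 - ‖y.1‖ ^ 2)) ^ p
  else 0

/-- Quadratic Taylor estimate for `t ↦ t ^ p` at `1`. -/
lemma abs_rpow_sub_taylor_le {p t : ℝ} (hp0 : 0 < p) (hp2 : p < 2) (ht : 1 / 2 ≤ t) :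
    |t ^ p - 1 - p * (t - 1)| ≤ 2 * p * (t - 1) ^ 2 := by
  have ht0 : 0 < t := by linarith
  have hs : -1 ≤ t - 1 := by linarith
  have e : 1 + (t - 1) = t := by ring
  have hsq := sq_nonneg (t - 1)
  rcases le_total p 1 with h1 | h1
  · have hu := rpow_one_add_le_one_add_mul_self hs hp0.le h1
    have hl := one_add_mul_self_le_rpow_one_add hs (p := p + 1) (by linarith)
    rw [e] at hu hl
    rw [Real.rpow_add_one ht0.ne'] at hl
    rw [abs_le]
    refine ⟨?_, by nlinarith [mul_nonneg hp0.le hsq]⟩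
    have key : (1 + p * (t - 1) - 2 * p * (t - 1) ^ 2) * t ≤ t ^ p * t := by
      nlinarith [mul_nonneg (mul_nonneg hp0.le hsq) (by linarith : 0 ≤ 2 * t - 1)]
    have := le_of_mul_le_mul_right key ht0
    linarith
  · have hl := one_add_mul_self_le_rpow_one_add hs h1
    have hu := rpow_one_add_le_one_add_mul_self hs (p := p - 1) (by linarith) (by linarith)
    rw [e] at hu hl
    have hm : t ^ p = t ^ (p - 1) * t := by
      rw [← Real.rpow_add_one ht0.ne']; ring_nf
    have := mul_le_mul_of_nonneg_right hu ht0.le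
    rw [← hm] at this
    rw [abs_le]
    constructor <;> nlinarith [mul_nonneg hp0.le hsq]

section SphereGraph

variable {F : Type*} [NormedAddCommGroup F]

lemma sqrt_sub_norm_sq_lower {r : ℝ} (hr : 0 < r) {x : F} (hx : ‖x‖ ≤ r / 2) :
    r / 2 ≤ √(r ^ 2 - ‖x‖ ^ 2) := by
  apply Real.le_sqrt_of_sq_le
  nlinarith [norm_nonneg x]

/-- The upper hemisphere is a Lipschitz graph over the ball of half the radius. -/
lemma abs_sqrt_sub_norm_sq_sub_le {r : ℝ} (hr : 0 < r) {x x' : F}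
    (hx : ‖x‖ ≤ r / 2) (hx' : ‖x'‖ ≤ r / 2) :
    |√(r ^ 2 - ‖x'‖ ^ 2) - √(r ^ 2 - ‖x‖ ^ 2)| ≤ ‖x' - x‖ := by
  have h1 := sqrt_sub_norm_sq_lower hr hx
  have h2 := sqrt_sub_norm_sq_lower hr hx'
  have s1 : √(r ^ 2 - ‖x‖ ^ 2) ^ 2 = r ^ 2 - ‖x‖ ^ 2 :=
    Real.sq_sqrt (by nlinarith [norm_nonneg x])
  have s2 : √(r ^ 2 - ‖x'‖ ^ 2) ^ 2 = r ^ 2 - ‖x'‖ ^ 2 :=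
    Real.sq_sqrt (by nlinarith [norm_nonneg x'])
  have hn := abs_norm_sub_norm_le x' x
  set a := √(r ^ 2 - ‖x‖ ^ 2)
  set b := √(r ^ 2 - ‖x'‖ ^ 2)
  rw [abs_le] at hn ⊢
  have n1 := norm_nonneg x
  have n2 := norm_nonneg x'
  have n3 := norm_nonneg (x' - x)
  have hab : 0 < a + b := by linarith
  have e : (b - a) * (a + b) = (‖x‖ - ‖x'‖) * (‖x‖ + ‖x'‖) := by nlinarith
  have k1 : (‖x‖ - ‖x'‖) * (‖x‖ + ‖x'‖) ≤ ‖x' - x‖ * (‖x‖ + ‖x'‖) :=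
    mul_le_mul_of_nonneg_right (by linarith) (by positivity)
  have k2 : -‖x' - x‖ * (‖x‖ + ‖x'‖) ≤ (‖x‖ - ‖x'‖) * (‖x‖ + ‖x'‖) :=
    mul_le_mul_of_nonneg_right (by linarith) (by positivity)
  have k3 : ‖x' - x‖ * (‖x‖ + ‖x'‖) ≤ ‖x' - x‖ * (a + b) :=
    mul_le_mul_of_nonneg_left (by linarith) n3
  constructor
  · refine le_of_mul_le_mul_right ?_ hab
    linarith
  · refine le_of_mul_le_mul_right ?_ hab
    linarith

variable [InnerProductSpace ℝ F]

/-- Second difference estimate for the upper hemisphere. -/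
lemma abs_sqrt_sub_norm_sq_second_diff_le {r : ℝ} (hr : 0 < r) {x w : F}
    (hx : ‖x‖ < r / 4) (hw : ‖w‖ ≤ r / 8) :
    |√(r ^ 2 - ‖x + w‖ ^ 2) + √(r ^ 2 - ‖x - w‖ ^ 2) - 2 * √(r ^ 2 - ‖x‖ ^ 2)|
      ≤ 6 * ‖w‖ ^ 2 / r := by
  set A := r ^ 2 - ‖x‖ ^ 2 with hA
  have n1 := norm_nonneg x
  have n2 := norm_nonneg w
  have hAl : 15 / 16 * r ^ 2 ≤ A := by nlinarith
  have hA0 : 0 < A := by nlinarith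
  have hAr : √A ≤ r := by
    rw [Real.sqrt_le_left hr.le]; nlinarith
  have hrA : r / 2 ≤ √A := sqrt_sub_norm_sq_lower hr (by linarith)
  set i := inner ℝ x w with hi
  have hia : |i| ≤ ‖x‖ * ‖w‖ := abs_real_inner_le_norm x w
  have h3 : ∀ c : ℝ, |c| = 1 → |√(A + (-2 * c * i - ‖w‖ ^ 2)) - √A
      - √A / 2 * ((-2 * c * i - ‖w‖ ^ 2) / A)| ≤ 2 * ‖w‖ ^ 2 / r := by
    intro c hc
    set v := -2 * c * i - ‖w‖ ^ 2 with hv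
    have hva : |v| ≤ ‖w‖ * (5 / 8 * r) := by
      have : |v| ≤ 2 * |i| + ‖w‖ ^ 2 := by
        rw [hv]
        refine (abs_sub _ _).trans ?_
        rw [abs_mul, abs_mul, hc, abs_of_nonneg (sq_nonneg ‖w‖)]
        norm_num
      nlinarith
    have hvr : |v| ≤ 5 / 64 * r ^ 2 := by nlinarith
    have hvl := neg_abs_le v
    have ht : 1 / 2 ≤ 1 + v / A := by
      have : -(1 / 2) ≤ v / A := by
        rw [le_div_iff₀ hA0]; nlinarith
      linarith
    have key := abs_rpow_sub_taylor_le (p := 1 / 2) (by norm_num) (by norm_num) ht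
    rw [← Real.sqrt_eq_rpow] at key
    have e : √(A + v) = √A * √(1 + v / A) := by
      rw [← Real.sqrt_mul hA0.le]; congr 1; field_simp
    have e2 : √(A + v) - √A - √A / 2 * (v / A)
        = √A * (√(1 + v / A) - 1 - 1 / 2 * (1 + v / A - 1)) := by rw [e]; ring
    rw [e2, abs_mul, abs_of_nonneg (Real.sqrt_nonneg A)]
    have hq : (v / A) ^ 2 ≤ ‖w‖ ^ 2 / r ^ 2 := by
      rw [div_pow, div_le_div_iff₀ (by positivity) (by positivity)]
      have a1 : v ^ 2 ≤ (‖w‖ * (5 / 8 * r)) ^ 2 := sq_le_sq' (by linarith) ((le_abs_self v).trans hva)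
      have a2 : (15 / 16 * r ^ 2) ^ 2 ≤ A ^ 2 := by gcongr
      calc v ^ 2 * r ^ 2 ≤ (‖w‖ * (5 / 8 * r)) ^ 2 * r ^ 2 := by gcongr
        _ ≤ ‖w‖ ^ 2 * (15 / 16 * r ^ 2) ^ 2 := by
          nlinarith [mul_nonneg (sq_nonneg ‖w‖) (sq_nonneg (r ^ 2))]
        _ ≤ _ := by gcongr
    calc √A * |√(1 + v / A) - 1 - 1 / 2 * (1 + v / A - 1)|
        ≤ r * (‖w‖ ^ 2 / r ^ 2) := by
          apply mul_le_mul hAr _ (abs_nonneg _) hr.le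
          refine key.trans ?_
          have : (1 + v / A - 1) = v / A := by ring
          rw [this]; linarith
      _ = ‖w‖ ^ 2 / r := by field_simp
      _ ≤ 2 * ‖w‖ ^ 2 / r := by gcongr; nlinarith
  have hp := h3 1 (by simp)
  have hm := h3 (-1) (by simp)
  have ep : r ^ 2 - ‖x + w‖ ^ 2 = A + (-2 * 1 * i - ‖w‖ ^ 2) := by
    rw [norm_add_sq_real]; ring
  have em : r ^ 2 - ‖x - w‖ ^ 2 = A + (-2 * (-1) * i - ‖w‖ ^ 2) := by
    rw [norm_sub_sq_real]; ring
  rw [ep, em]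
  have hlin : √A / 2 * ((-2 * 1 * i - ‖w‖ ^ 2) / A) + √A / 2 * ((-2 * (-1) * i - ‖w‖ ^ 2) / A)
      = -(‖w‖ ^ 2 / √A) := by
    have h0 : √A ≠ 0 := by positivity
    have hs : √A ^ 2 = A := Real.sq_sqrt hA0.le
    rw [← hs]
    have : √(√A ^ 2) = √A := Real.sqrt_sq (Real.sqrt_nonneg A)
    rw [this]
    field_simp
    ring
  have hb : ‖w‖ ^ 2 / √A ≤ 2 * ‖w‖ ^ 2 / r := by
    rw [div_le_div_iff₀ (by linarith) hr]
    nlinarith [sq_nonneg ‖w‖]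
  have hb0 : 0 ≤ ‖w‖ ^ 2 / √A := by positivity
  have h6 : 6 * ‖w‖ ^ 2 / r = 3 * (2 * ‖w‖ ^ 2 / r) := by ring
  rw [abs_le] at hp hm ⊢
  rw [h6]
  constructor <;> linarith [hp.1, hp.2, hm.1, hm.2]

end SphereGraph

section RadialIntegral

variable {E : Type*} [NormedAddCommGroup E] [NormedSpace ℝ E] [FiniteDimensional ℝ E]
  [Nontrivial E] [MeasurableSpace E] [BorelSpace E] (μ : Measure E) [μ.IsAddHaarMeasure]

/-- Integral of a power of the norm over an annulus, in polar coordinates. -/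
lemma integral_indicator_norm_rpow {a b q : ℝ} (ha : 0 ≤ a) (hab : a ≤ b)
    (hint : IntervalIntegrable (fun t : ℝ => t ^ ((Module.finrank ℝ E : ℝ) - 1 + q)) volume a b) :
    Integrable (fun x : E => (Ioc a b).indicator (fun t : ℝ => t ^ q) ‖x‖) μ ∧
    ∫ x : E, (Ioc a b).indicator (fun t : ℝ => t ^ q) ‖x‖ ∂μ =
      Module.finrank ℝ E * μ.real (Metric.ball 0 1) *
        ∫ t in a..b, t ^ ((Module.finrank ℝ E : ℝ) - 1 + q) := by
  have hdim : 1 ≤ Module.finrank ℝ E := Module.finrank_pos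
  have hsub : Ioc a b ⊆ Ioi 0 := fun t ht => ha.trans_lt ht.1
  have hfun : EqOn (fun t : ℝ => t ^ (Module.finrank ℝ E - 1) •
      (Ioc a b).indicator (fun t : ℝ => t ^ q) t)
      ((Ioc a b).indicator fun t : ℝ => t ^ ((Module.finrank ℝ E : ℝ) - 1 + q)) (Ioi 0) := by
    intro t ht
    by_cases h : t ∈ Ioc a b
    · simp only [indicator_of_mem h, smul_eq_mul]
      rw [Real.rpow_add ht, ← Real.rpow_natCast t (Module.finrank ℝ E - 1), Nat.cast_sub hdim,
        Nat.cast_one]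
    · simp [indicator_of_notMem h]
  constructor
  · rw [integrable_fun_norm_addHaar μ (f := (Ioc a b).indicator (fun t : ℝ => t ^ q)),
      integrableOn_congr_fun hfun measurableSet_Ioi]
    rw [intervalIntegrable_iff_integrableOn_Ioc_of_le hab] at hint
    exact (hint.integrable_indicator measurableSet_Ioc).integrableOn
  · rw [integral_fun_norm_addHaar μ ((Ioc a b).indicator (fun t : ℝ => t ^ q)),
      setIntegral_congr_fun measurableSet_Ioi hfun, setIntegral_indicator measurableSet_Ioc,
      inter_eq_self_of_subset_right hsub, intervalIntegral.integral_of_le hab]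
    simp only [nsmul_eq_mul, smul_eq_mul, mul_assoc]

end RadialIntegral

section EuclideanNorm

variable {m : ℕ}

instance isAddHaarMeasure_volume_euclideanSpace_prod :
    (volume : Measure (EuclideanSpace ℝ (Fin m) × ℝ)).IsAddHaarMeasure :=
  Measure.prod.instIsAddHaarMeasure _ _

lemma enorm'_sq (w : EuclideanSpace ℝ (Fin m) × ℝ) : enorm' w ^ 2 = ‖w.1‖ ^ 2 + w.2 ^ 2 :=
  Real.sq_sqrt (by positivity)

lemma enorm'_nonneg (w : EuclideanSpace ℝ (Fin m) × ℝ) : 0 ≤ enorm' w := Real.sqrt_nonneg _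

lemma enorm'_neg (w : EuclideanSpace ℝ (Fin m) × ℝ) : enorm' (-w) = enorm' w := by
  simp [enorm']

lemma continuous_enorm' : Continuous (enorm' : EuclideanSpace ℝ (Fin m) × ℝ → ℝ) := by
  unfold enorm'; fun_prop

lemma norm_fst_le_enorm' (w : EuclideanSpace ℝ (Fin m) × ℝ) : ‖w.1‖ ≤ enorm' w :=
  Real.le_sqrt_of_sq_le (by nlinarith [sq_nonneg w.2])

lemma abs_snd_le_enorm' (w : EuclideanSpace ℝ (Fin m) × ℝ) : |w.2| ≤ enorm' w :=
  Real.le_sqrt_of_sq_le (by nlinarith [sq_nonneg ‖w.1‖, sq_abs w.2])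

lemma norm_le_enorm' (w : EuclideanSpace ℝ (Fin m) × ℝ) : ‖w‖ ≤ enorm' w := by
  rw [Prod.norm_def, Real.norm_eq_abs]
  exact max_le (norm_fst_le_enorm' w) (abs_snd_le_enorm' w)

lemma enorm'_sq_le (w : EuclideanSpace ℝ (Fin m) × ℝ) : enorm' w ^ 2 ≤ 2 * ‖w‖ ^ 2 := by
  rw [enorm'_sq, ← sq_abs w.2, ← Real.norm_eq_abs]
  have h1 : ‖w.1‖ ≤ ‖w‖ := norm_fst_le w
  have h2 : ‖w.2‖ ≤ ‖w‖ := norm_snd_le w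
  have := pow_le_pow_left₀ (norm_nonneg _) h1 2
  have := pow_le_pow_left₀ (norm_nonneg _) h2 2
  linarith

lemma enorm'_le (w : EuclideanSpace ℝ (Fin m) × ℝ) : enorm' w ≤ 2 * ‖w‖ := by
  have := enorm'_sq_le w
  nlinarith [norm_nonneg w, enorm'_nonneg w]

end EuclideanNorm

/-- A dominated symmetric second difference makes the truncated principal value converge. -/
lemma exists_tendsto_pvInt2Tr {d : ℕ} {α M : ℝ} {u : EuclideanSpace ℝ (Fin (d - 1)) × ℝ → ℝ}
    (y : EuclideanSpace ℝ (Fin (d - 1)) × ℝ) (hp : 0 < (d : ℝ) + α) (hu : Measurable u)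
    (huM : ∀ z, |u z| ≤ M) {B : EuclideanSpace ℝ (Fin (d - 1)) × ℝ → ℝ} (hB : Integrable B)
    (hB0 : ∀ w, 0 ≤ B w)
    (hle : ∀ w, 0 < enorm' w → enorm' w ≤ 1 →
      |(u (y + w) + u (y - w)) / 2 - u y| / enorm' w ^ ((d : ℝ) + α) ≤ B w) :
    ∃ L : ℝ, Tendsto (pvInt2Tr d α u y) (nhdsWithin 0 (Ioi 0)) (nhds L) ∧ |L| ≤ ∫ w, B w := by
  set A : ℝ → Set (EuclideanSpace ℝ (Fin (d - 1)) × ℝ) :=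
    fun ε => {w | ε < enorm' w ∧ enorm' w ≤ 1} with hA
  have hAm : ∀ ε, MeasurableSet (A ε) := fun ε =>
    (measurableSet_lt measurable_const continuous_enorm'.measurable).inter
      (measurableSet_le continuous_enorm'.measurable measurable_const)
  have hAfin : ∀ ε, volume (A ε) < ⊤ := by
    intro ε
    refine (measure_mono (t := Metric.closedBall 0 1) ?_).trans_lt
      Metric.isBounded_closedBall.measure_lt_top
    intro w hw
    rw [mem_closedBall_zero_iff]
    exact (norm_le_enorm' w).trans hw.2
  have hAneg : ∀ ε w, -w ∈ A ε ↔ w ∈ A ε := by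
    intro ε w; simp [hA, enorm'_neg]
  set k : EuclideanSpace ℝ (Fin (d - 1)) × ℝ → ℝ :=
    fun w => (u (y + w) - u y) / enorm' w ^ ((d : ℝ) + α) with hk
  set g : EuclideanSpace ℝ (Fin (d - 1)) × ℝ → ℝ :=
    fun w => ((u (y + w) + u (y - w)) / 2 - u y) / enorm' w ^ ((d : ℝ) + α) with hg
  have hkm : Measurable k :=
    ((hu.comp (measurable_const_add y)).sub_const _).div
      (continuous_enorm'.measurable.pow_const _)
  have hgm : Measurable g :=
    ((((hu.comp (measurable_const_add y)).add
      (hu.comp (measurable_const.sub measurable_id))).div_const 2).sub_const _).div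
      (continuous_enorm'.measurable.pow_const _)
  have hgk : ∀ w, g w = (k w + k (-w)) / 2 := by
    intro w
    simp only [hg, hk, enorm'_neg, ← sub_eq_add_neg]
    ring
  have hgB : ∀ w, 0 < enorm' w → enorm' w ≤ 1 → ‖g w‖ ≤ B w := by
    intro w h0 h1
    rw [Real.norm_eq_abs, hg]
    simp only
    rw [abs_div, abs_of_nonneg (Real.rpow_nonneg (enorm'_nonneg w) _)]
    exact hle w h0 h1
  have hkint : ∀ ε > 0, IntegrableOn k (A ε) := by
    intro ε hε
    refine IntegrableOn.of_bound (hAfin ε) hkm.aestronglyMeasurable (2 * M / ε ^ ((d : ℝ) + α)) ?_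
    refine (ae_restrict_iff' (hAm ε)).2 (Eventually.of_forall fun w hw => ?_)
    rw [Real.norm_eq_abs, hk]
    simp only
    rw [abs_div, abs_of_nonneg (Real.rpow_nonneg (enorm'_nonneg w) _)]
    have h1 := huM (y + w)
    have h2 := huM y
    have hε' : 0 < ε ^ ((d : ℝ) + α) := Real.rpow_pos_of_pos hε _
    have h3 : |u (y + w) - u y| ≤ 2 * M := (abs_sub _ _).trans (by linarith)
    exact div_le_div₀ ((abs_nonneg _).trans h3) h3 hε'
      (Real.rpow_le_rpow hε.le hw.1.le hp.le)
  have hpv : ∀ ε > 0, pvInt2Tr d α u y ε = ∫ w, (A ε).indicator g w := by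
    intro ε hε
    have e1 : pvInt2Tr d α u y ε = ∫ w, (A ε).indicator k w := by
      unfold pvInt2Tr
      have hm : MeasurableSet {z : EuclideanSpace ℝ (Fin (d - 1)) × ℝ |
          ε < enorm' (z - y) ∧ enorm' (z - y) ≤ 1} := (hAm ε).preimage (measurable_sub_const y)
      rw [← integral_indicator hm, ← integral_add_left_eq_self _ y]
      congr 1
      ext w
      have hn : enorm' (y - (y + w)) = enorm' w := by
        rw [← enorm'_neg w]; congr 1; abel
      simp only [indicator, mem_ofPred_eq, hA, hk, add_sub_cancel_left, hn]
    have e2 : ∫ w, (A ε).indicator k w = ∫ w, (A ε).indicator (fun w => k (-w)) w := by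
      rw [← integral_neg_eq_self]
      congr 1
      ext w
      simp only [indicator, hAneg]
    have i1 : Integrable ((A ε).indicator k) := (hkint ε hε).integrable_indicator (hAm ε)
    have i2 : Integrable ((A ε).indicator fun w => k (-w)) := by
      refine (i1.comp_neg).congr (Eventually.of_forall fun w => ?_)
      simp only [indicator, hAneg]
    have e3 : ∀ w, (A ε).indicator g w =
        ((A ε).indicator k w + (A ε).indicator (fun w => k (-w)) w) / 2 := by
      intro w
      by_cases h : w ∈ A ε <;> simp [h, hgk]
    simp_rw [e3]
    rw [integral_div, integral_add i1 i2, ← e2, e1]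
    ring
  refine ⟨∫ w, (A 0).indicator g w, ?_, ?_⟩
  · have hT : Tendsto (fun ε => ∫ w, (A ε).indicator g w) (nhdsWithin 0 (Ioi 0))
        (nhds (∫ w, (A 0).indicator g w)) := by
      refine tendsto_integral_filter_of_dominated_convergence B ?_ ?_ hB ?_
      · exact Eventually.of_forall fun ε => (hgm.indicator (hAm ε)).aestronglyMeasurable
      · filter_upwards [self_mem_nhdsWithin] with ε hε
        refine Eventually.of_forall fun w => ?_
        by_cases h : w ∈ A ε
        · rw [indicator_of_mem h]
          exact hgB w (lt_trans hε h.1) h.2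
        · rw [indicator_of_notMem h, norm_zero]
          exact hB0 w
      · refine Eventually.of_forall fun w => ?_
        refine tendsto_const_nhds.congr' ?_
        by_cases h0 : 0 < enorm' w
        · filter_upwards [nhdsWithin_le_nhds (Iio_mem_nhds h0)] with ε hε
          have hε' : ε < enorm' w := hε
          simp only [indicator, hA, mem_ofPred_eq, h0, hε', true_and]
        · filter_upwards [self_mem_nhdsWithin] with ε hε
          have hε' : ¬ ε < enorm' w := fun h => h0 (lt_trans hε h)
          simp only [indicator, hA, mem_ofPred_eq, h0, hε', false_and]
    refine hT.congr' ?_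
    filter_upwards [self_mem_nhdsWithin] with ε hε
    exact (hpv ε hε).symm
  · rw [← Real.norm_eq_abs]
    refine norm_integral_le_of_norm_le hB (Eventually.of_forall fun w => ?_)
    by_cases h : w ∈ A 0
    · rw [indicator_of_mem h]
      exact hgB w h.1 h.2
    · rw [indicator_of_notMem h, norm_zero]
      exact hB0 w

section CapFunction

variable {d : ℕ} {r p : ℝ}

lemma measurable_hfun : Measurable (hfun d r p) := by
  have hN := (continuous_enorm' (m := d - 1)).measurable
  unfold hfun
  refine Measurable.ite ?_ ?_ measurable_const
  · exact (measurableSet_lt measurable_const hN).inter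
      ((measurableSet_lt hN measurable_const).inter
        ((measurableSet_lt measurable_const measurable_snd).inter
          (measurableSet_lt measurable_fst.norm measurable_const)))
  · exact Measurable.pow_const (by fun_prop) _

lemma sqrt_lt_snd_of_lt_enorm' {z : EuclideanSpace ℝ (Fin (d - 1)) × ℝ} (hr : 0 < r)
    (h1 : r < enorm' z) (h2 : 0 < z.2) : √(r ^ 2 - ‖z.1‖ ^ 2) < z.2 := by
  rw [Real.sqrt_lt' h2]
  have := enorm'_sq z
  nlinarith

lemma hfun_nonneg (hr : 0 < r) (z : EuclideanSpace ℝ (Fin (d - 1)) × ℝ) :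
    0 ≤ hfun d r p z := by
  unfold hfun
  split_ifs with h
  · exact Real.rpow_nonneg (sub_nonneg.2 (sqrt_lt_snd_of_lt_enorm' hr h.1 h.2.2.1).le) _
  · exact le_rfl

lemma hfun_le_one (hr : 0 < r) (hr2 : r ≤ 1 / 2) (hp : 0 < p)
    (z : EuclideanSpace ℝ (Fin (d - 1)) × ℝ) : hfun d r p z ≤ 1 := by
  unfold hfun
  split_ifs with h
  · have h1 := sqrt_lt_snd_of_lt_enorm' hr h.1 h.2.2.1
    have h2 := (le_abs_self _).trans (abs_snd_le_enorm' z)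
    have h3 := Real.sqrt_nonneg (r ^ 2 - ‖z.1‖ ^ 2)
    exact Real.rpow_le_one (by linarith) (by linarith [h.2.1]) hp.le
  · exact zero_le_one

/-- The height above the sphere is `2`-Lipschitz for the Euclidean norm. -/
lemma abs_height_sub_le {y z : EuclideanSpace ℝ (Fin (d - 1)) × ℝ} (hr : 0 < r)
    (hy : ‖y.1‖ ≤ r / 2) (hz : ‖z.1‖ ≤ r / 2) :
    |(z.2 - √(r ^ 2 - ‖z.1‖ ^ 2)) - (y.2 - √(r ^ 2 - ‖y.1‖ ^ 2))| ≤ 2 * enorm' (z - y) := by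
  have h1 := abs_sqrt_sub_norm_sq_sub_le hr hy hz
  have h2 := norm_fst_le_enorm' (z - y)
  have h3 := abs_snd_le_enorm' (z - y)
  simp only [Prod.fst_sub, Prod.snd_sub] at h2 h3
  rw [abs_le] at h1 h3 ⊢
  constructor <;> linarith [h1.1, h1.2, h3.1, h3.2]

lemma hfun_le_of_lt_enorm' {y z : EuclideanSpace ℝ (Fin (d - 1)) × ℝ} {s n : ℝ} (hr : 0 < r)
    (hp0 : 0 < p) (hp2 : p < 2) (hy : ‖y.1‖ ≤ r / 2) (hs : s = y.2 - √(r ^ 2 - ‖y.1‖ ^ 2))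
    (hn : enorm' (z - y) ≤ n) (hsn : s / 4 < n) (hn0 : 0 < n) : hfun d r p z ≤ 36 * n ^ p := by
  unfold hfun
  split_ifs with h
  · have h1 := abs_height_sub_le hr hy h.2.2.2.le
    have h2 := sqrt_lt_snd_of_lt_enorm' hr h.1 h.2.2.1
    rw [abs_le] at h1
    calc (z.2 - √(r ^ 2 - ‖z.1‖ ^ 2)) ^ p ≤ (6 * n) ^ p :=
          Real.rpow_le_rpow (by linarith) (by linarith [h1.2]) hp0.le
      _ = 6 ^ p * n ^ p := Real.mul_rpow (by norm_num) hn0.le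
      _ ≤ 36 * n ^ p := by
        gcongr
        calc (6 : ℝ) ^ p ≤ 6 ^ (2 : ℝ) := Real.rpow_le_rpow_of_exponent_le (by norm_num) hp2.le
          _ = 36 := by norm_num
  · positivity

lemma hfun_eq_of_pos {z : EuclideanSpace ℝ (Fin (d - 1)) × ℝ} (hr : 0 < r)
    (h1 : ‖z.1‖ < r / 2) (h2 : enorm' z < 3 * r / 2) (h3 : 0 < z.2 - √(r ^ 2 - ‖z.1‖ ^ 2)) :
    hfun d r p z = (z.2 - √(r ^ 2 - ‖z.1‖ ^ 2)) ^ p := by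
  have h4 := sqrt_sub_norm_sq_lower hr h1.le
  have h5 : √(r ^ 2 - ‖z.1‖ ^ 2) ^ 2 = r ^ 2 - ‖z.1‖ ^ 2 :=
    Real.sq_sqrt (by nlinarith [norm_nonneg z.1])
  have h6 := enorm'_sq z
  have h7 := enorm'_nonneg z
  have h8 : r < enorm' z := by
    apply lt_of_pow_lt_pow_left₀ 2 h7
    nlinarith
  exact if_pos ⟨h8, h2, by linarith, h1⟩

lemma enorm'_add_le (y w : EuclideanSpace ℝ (Fin (d - 1)) × ℝ) :
    enorm' (y + w) ≤ enorm' y + 2 * enorm' w := by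
  have hy0 := enorm'_nonneg y
  have hw0 := enorm'_nonneg w
  have h1 : ‖y.1 + w.1‖ ^ 2 ≤ (‖y.1‖ + ‖w.1‖) ^ 2 := by gcongr; exact norm_add_le _ _
  have h2 : (y.2 + w.2) ^ 2 ≤ (|y.2| + |w.2|) ^ 2 := by
    rw [← sq_abs (y.2 + w.2)]; gcongr; exact abs_add_le _ _
  have h3 := mul_le_mul (norm_fst_le_enorm' y) (norm_fst_le_enorm' w) (norm_nonneg _) hy0
  have h4 := mul_le_mul (abs_snd_le_enorm' y) (abs_snd_le_enorm' w) (abs_nonneg _) hy0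
  refine (sq_le_sq₀ (enorm'_nonneg _) (by positivity)).1 ?_
  rw [enorm'_sq, Prod.fst_add, Prod.snd_add]
  nlinarith [enorm'_sq y, enorm'_sq w, sq_abs y.2, sq_abs w.2, sq_nonneg (enorm' w)]

/-- Second difference estimate for the cap function near a point at height `s`. -/
lemma abs_hfun_second_diff_le {y w : EuclideanSpace ℝ (Fin (d - 1)) × ℝ} {s : ℝ} (hr : 0 < r)
    (hr2 : r ≤ 1 / 2) (hp0 : 0 < p) (hp2 : p < 2) (hy : ‖y.1‖ < r / 4)
    (hyN : enorm' y < r + r / 4) (hs : s = y.2 - √(r ^ 2 - ‖y.1‖ ^ 2)) (hs0 : 0 < s)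
    (hsr : s ≤ r / 2) (hw : enorm' w ≤ s / 4) :
    |(hfun d r p (y + w) + hfun d r p (y - w)) / 2 - hfun d r p y|
      ≤ 19 * s ^ (p - 2) * enorm' w ^ 2 := by
  have hw1 := norm_fst_le_enorm' w
  have hN0 := enorm'_nonneg w
  have hyp : ‖(y + w).1‖ < r / 2 := (norm_add_le _ _).trans_lt (by linarith)
  have hym : ‖(y - w).1‖ < r / 2 := (norm_sub_le _ _).trans_lt (by linarith)
  have hNp : enorm' (y + w) < 3 * r / 2 := (enorm'_add_le y w).trans_lt (by linarith)
  have hNm : enorm' (y - w) < 3 * r / 2 := by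
    rw [sub_eq_add_neg]
    refine (enorm'_add_le y (-w)).trans_lt ?_
    rw [enorm'_neg]
    linarith
  have hlp := abs_height_sub_le (y := y) hr (by linarith) hyp.le
  have hlm := abs_height_sub_le (y := y) hr (by linarith) hym.le
  have e1 : enorm' (y + w - y) = enorm' w := by rw [add_sub_cancel_left]
  have e2 : enorm' (y - w - y) = enorm' w := by rw [sub_sub_cancel_left, enorm'_neg]
  rw [← hs, e1] at hlp
  rw [← hs, e2] at hlm
  have hsec := abs_sqrt_sub_norm_sq_second_diff_le hr hy (w := w.1) (by linarith)
  have hap := hfun_eq_of_pos (p := p) hr hyp hNp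
  have ham := hfun_eq_of_pos (p := p) hr hym hNm
  have hay := hfun_eq_of_pos (p := p) hr (z := y) (by linarith) (by linarith)
  rw [← hs] at hay
  have hsum : (y + w).2 + (y - w).2 = 2 * y.2 := by
    simp only [Prod.snd_add, Prod.snd_sub]; ring
  have hd : |((y + w).2 - √(r ^ 2 - ‖(y + w).1‖ ^ 2)) + ((y - w).2 - √(r ^ 2 - ‖(y - w).1‖ ^ 2))
      - 2 * s| ≤ 6 * enorm' w ^ 2 / r := by
    have h1 : 6 * ‖w.1‖ ^ 2 / r ≤ 6 * enorm' w ^ 2 / r := by gcongr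
    refine le_trans (le_of_eq ?_) (hsec.trans h1)
    rw [← abs_neg, hs]
    congr 1
    simp only [Prod.fst_add, Prod.fst_sub] at *
    linarith
  set a := (y + w).2 - √(r ^ 2 - ‖(y + w).1‖ ^ 2)
  set b := (y - w).2 - √(r ^ 2 - ‖(y - w).1‖ ^ 2)
  set n := enorm' w
  have ha : s / 2 ≤ a := by linarith [(abs_le.1 hlp).1]
  have hb : s / 2 ≤ b := by linarith [(abs_le.1 hlm).1]
  rw [hap (by linarith), ham (by linarith), hay hs0]
  have hT : ∀ c, s / 2 ≤ c → |c - s| ≤ 2 * n →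
      |(c / s) ^ p - 1 - p * (c / s - 1)| ≤ 8 * p * (n ^ 2 / s ^ 2) := by
    intro c hc hcn
    refine (abs_rpow_sub_taylor_le hp0 hp2 (by rw [le_div_iff₀ hs0]; linarith)).trans ?_
    have h1 : (c / s - 1) ^ 2 = (c - s) ^ 2 / s ^ 2 := by field_simp
    have h2 : (c - s) ^ 2 ≤ 4 * n ^ 2 := by
      rw [← sq_abs]; nlinarith [abs_nonneg (c - s)]
    have h3 : (c - s) ^ 2 / s ^ 2 ≤ 4 * n ^ 2 / s ^ 2 := by gcongr
    rw [h1]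
    have h4 : 8 * p * (n ^ 2 / s ^ 2) = 2 * p * (4 * n ^ 2 / s ^ 2) := by ring
    rw [h4]
    gcongr
  have hTa := hT a ha hlp
  have hTb := hT b hb hlm
  have hlin : |p * (a / s - 1) + p * (b / s - 1)| ≤ 3 * p * (n ^ 2 / s ^ 2) := by
    have h1 : p * (a / s - 1) + p * (b / s - 1) = p * ((a + b - 2 * s) / s) := by
      field_simp; ring
    rw [h1, abs_mul, abs_of_pos hp0, abs_div, abs_of_pos hs0]
    have h2 : 6 * n ^ 2 / r ≤ 3 * n ^ 2 / s := by
      rw [div_le_div_iff₀ hr hs0]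
      nlinarith [sq_nonneg n]
    calc p * (|a + b - 2 * s| / s) ≤ p * ((3 * n ^ 2 / s) / s) := by
          gcongr; exact hd.trans h2
      _ = _ := by field_simp
  have hsplit : (a ^ p + b ^ p) / 2 - s ^ p
      = s ^ p * (((a / s) ^ p + (b / s) ^ p) / 2 - 1) := by
    rw [Real.div_rpow (by linarith) hs0.le, Real.div_rpow (by linarith) hs0.le]
    have := (Real.rpow_pos_of_pos hs0 p).ne'
    field_simp
  have hmain : |((a / s) ^ p + (b / s) ^ p) / 2 - 1| ≤ 19 * (n ^ 2 / s ^ 2) := by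
    have h0 : 0 ≤ n ^ 2 / s ^ 2 := by positivity
    have h1 := mul_le_mul_of_nonneg_right hp2.le h0
    rw [abs_le] at *
    constructor <;> linarith [hTa.1, hTa.2, hTb.1, hTb.2, hlin.1, hlin.2]
  rw [hsplit, abs_mul, abs_of_pos (Real.rpow_pos_of_pos hs0 p)]
  calc s ^ p * |((a / s) ^ p + (b / s) ^ p) / 2 - 1| ≤ s ^ p * (19 * (n ^ 2 / s ^ 2)) := by gcongr
    _ = 19 * s ^ (p - 2) * n ^ 2 := by
      rw [Real.rpow_sub hs0, Real.rpow_two]; ring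

end CapFunction

/-- Radial majorant of the symmetrised integrand of the cap function at height `s`. -/
noncomputable def hfunMajorant (d : ℕ) (α s : ℝ) (w : EuclideanSpace ℝ (Fin (d - 1)) × ℝ) : ℝ :=
  38 * s ^ (α - 2) * (Ioc 0 s).indicator (fun t : ℝ => t ^ (2 - d - α)) ‖w‖ +
    36 * (Ioc (s / 8) 1).indicator (fun t : ℝ => t ^ (-(d : ℝ))) ‖w‖

lemma hfunMajorant_nonneg {d : ℕ} {α s : ℝ} (hs : 0 ≤ s)
    (w : EuclideanSpace ℝ (Fin (d - 1)) × ℝ) : 0 ≤ hfunMajorant d α s w := by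
  have h1 : 0 ≤ (Ioc 0 s).indicator (fun t : ℝ => t ^ (2 - d - α)) ‖w‖ :=
    indicator_apply_nonneg fun _ => Real.rpow_nonneg (norm_nonneg w) _
  have h2 : 0 ≤ (Ioc (s / 8) 1).indicator (fun t : ℝ => t ^ (-(d : ℝ))) ‖w‖ :=
    indicator_apply_nonneg fun _ => Real.rpow_nonneg (norm_nonneg w) _
  unfold hfunMajorant
  positivity

lemma integrable_hfunMajorant {d : ℕ} {α s : ℝ} (hd : 1 ≤ d) (hα : α < 2) (hs0 : 0 < s)
    (hs1 : s ≤ 1) :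
    Integrable (hfunMajorant d α s) ∧
    ∫ w, hfunMajorant d α s w =
      d * (volume : Measure (EuclideanSpace ℝ (Fin (d - 1)) × ℝ)).real (Metric.ball 0 1) *
        (38 / (2 - α) + 36 * Real.log (8 / s)) := by
  have hdim : Module.finrank ℝ (EuclideanSpace ℝ (Fin (d - 1)) × ℝ) = d := by
    simp [hd]
  have hα' : 2 - α ≠ 0 := by linarith
  have e1 : (d : ℝ) - 1 + (2 - d - α) = 1 - α := by ring
  have e2 : (d : ℝ) - 1 + -(d : ℝ) = -1 := by ring
  have hn := integral_indicator_norm_rpow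
    (volume : Measure (EuclideanSpace ℝ (Fin (d - 1)) × ℝ)) (q := 2 - d - α) le_rfl hs0.le
    (by rw [hdim, e1]; exact intervalIntegral.intervalIntegrable_rpow' (by linarith))
  have h0 : (0 : ℝ) ∉ uIcc (s / 8) 1 := notMem_uIcc_of_lt (by positivity) one_pos
  have hf := integral_indicator_norm_rpow
    (volume : Measure (EuclideanSpace ℝ (Fin (d - 1)) × ℝ)) (q := -(d : ℝ))
    (a := s / 8) (b := 1) (by positivity) (by linarith)
    (by rw [hdim, e2]; exact intervalIntegral.intervalIntegrable_rpow (Or.inr h0))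
  rw [hdim, e1, integral_rpow (Or.inl (by linarith))] at hn
  rw [hdim, e2] at hf
  simp only [Real.rpow_neg_one] at hf
  rw [integral_inv_of_pos (by positivity) one_pos] at hf
  unfold hfunMajorant
  refine ⟨(hn.1.const_mul _).add (hf.1.const_mul _), ?_⟩
  rw [integral_add (hn.1.const_mul _) (hf.1.const_mul _), integral_const_mul, integral_const_mul,
    hn.2, hf.2]
  have e3 : 1 - α + 1 = 2 - α := by ring
  have e4 : s ^ (α - 2) * s ^ (2 - α) = 1 := by
    rw [← Real.rpow_add hs0]; simp
  have e5 : (1 : ℝ) / (s / 8) = 8 / s := by field_simp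
  rw [e3, e5, Real.zero_rpow hα', sub_zero]
  calc _ = d * (volume : Measure (EuclideanSpace ℝ (Fin (d - 1)) × ℝ)).real (Metric.ball 0 1) *
        (38 * (s ^ (α - 2) * s ^ (2 - α)) / (2 - α) + 36 * Real.log (8 / s)) := by ring
    _ = _ := by rw [e4, mul_one]

lemma hfun_second_diff_div_le {d : ℕ} {r α s : ℝ} {y w : EuclideanSpace ℝ (Fin (d - 1)) × ℝ}
    (hr : 0 < r) (hr2 : r ≤ 1 / 2) (hα0 : 0 < α) (hα2 : α < 2) (hy : ‖y.1‖ < r / 4)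
    (hyN : enorm' y < r + r / 4) (hs : s = y.2 - √(r ^ 2 - ‖y.1‖ ^ 2)) (hs0 : 0 < s)
    (hsr : s ≤ r / 2) (hw0 : 0 < enorm' w) (hw1 : enorm' w ≤ 1) :
    |(hfun d r α (y + w) + hfun d r α (y - w)) / 2 - hfun d r α y| / enorm' w ^ ((d : ℝ) + α)
      ≤ hfunMajorant d α s w := by
  have hwn := norm_le_enorm' w
  have hnw := enorm'_le w
  have hw : 0 < ‖w‖ := by linarith
  have hi1 : 0 ≤ (Ioc 0 s).indicator (fun t : ℝ => t ^ (2 - d - α)) ‖w‖ :=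
    indicator_apply_nonneg fun _ => Real.rpow_nonneg (norm_nonneg w) _
  have hi2 : 0 ≤ (Ioc (s / 8) 1).indicator (fun t : ℝ => t ^ (-(d : ℝ))) ‖w‖ :=
    indicator_apply_nonneg fun _ => Real.rpow_nonneg (norm_nonneg w) _
  have hsp : 0 < s ^ (α - 2) := Real.rpow_pos_of_pos hs0 _
  unfold hfunMajorant
  rcases le_or_gt (enorm' w) (s / 4) with h | h
  · have key := abs_hfun_second_diff_le hr hr2 hα0 hα2 hy hyN hs hs0 hsr h
    have hmem : ‖w‖ ∈ Ioc 0 s := ⟨hw, by linarith⟩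
    rw [indicator_of_mem hmem] at hi1 ⊢
    have hsq := enorm'_sq_le w
    calc _ ≤ 19 * s ^ (α - 2) * (2 * ‖w‖ ^ 2) / ‖w‖ ^ ((d : ℝ) + α) := by
          apply div_le_div₀ (by positivity) (key.trans (by gcongr)) (Real.rpow_pos_of_pos hw _)
          exact Real.rpow_le_rpow hw.le hwn (by positivity)
      _ = 38 * s ^ (α - 2) * ‖w‖ ^ (2 - d - α) := by
          rw [sub_sub, Real.rpow_sub hw, Real.rpow_two]; ring
      _ ≤ _ := le_add_of_nonneg_right (by positivity)
  · have hbd : ∀ z, enorm' (z - y) ≤ enorm' w → hfun d r α z ≤ 36 * enorm' w ^ α := fun z hz =>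
      hfun_le_of_lt_enorm' hr hα0 hα2 (by linarith) hs hz h hw0
    have b1 := hbd (y + w) (by rw [add_sub_cancel_left])
    have b2 := hbd (y - w) (by rw [sub_sub_cancel_left, enorm'_neg])
    have b3 := hbd y (by rw [sub_self]; simp [enorm'])
    have key : |(hfun d r α (y + w) + hfun d r α (y - w)) / 2 - hfun d r α y|
        ≤ 36 * enorm' w ^ α := by
      have c1 := hfun_nonneg (p := α) hr (y + w)
      have c2 := hfun_nonneg (p := α) hr (y - w)
      have c3 := hfun_nonneg (p := α) hr y
      rw [abs_le]
      constructor <;> linarith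
    have hmem : ‖w‖ ∈ Ioc (s / 8) 1 := ⟨by linarith, by linarith⟩
    rw [indicator_of_mem hmem] at hi2 ⊢
    have hNp : 0 < enorm' w ^ ((d : ℝ) + α) := Real.rpow_pos_of_pos hw0 _
    calc _ ≤ 36 * enorm' w ^ α / enorm' w ^ ((d : ℝ) + α) := by gcongr
      _ = 36 * enorm' w ^ (-(d : ℝ)) := by
          rw [mul_div_assoc, ← Real.rpow_sub hw0]; congr 2; ring
      _ ≤ 36 * ‖w‖ ^ (-(d : ℝ)) := by
          gcongr 36 * ?_
          exact Real.rpow_le_rpow_of_nonpos hw hwn (by simp)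
      _ ≤ _ := le_add_of_nonneg_left (by positivity)

/-- There exist `δ ∈ (0, r₁/4]` and a constant `C > 0` such that for every `y` with
`y_d > 0`, `r₁ < |y| < r₁ + δ`, `|ỹ| < r₁/4`, the limit defining the truncated
fractional Laplacian `Δ̂^{α/2} h_α(y)` exists and
`|Δ̂^{α/2} h_α(y)| ≤ C |log(y_d - √(r₁²-|ỹ|²))|`. -/
theorem statement9 (d : ℕ) (hd : 1 ≤ d) (α : ℝ) (hα : α ∈ Set.Ioo (0 : ℝ) 2)
    (r1 : ℝ) (hr1 : r1 ∈ Set.Ioc (0 : ℝ) (1 / 2)) :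
    ∃ δ ∈ Set.Ioc (0 : ℝ) (r1 / 4), ∃ C : ℝ, 0 < C ∧
      ∀ y : EuclideanSpace ℝ (Fin (d - 1)) × ℝ,
        0 < y.2 → r1 < enorm' y → enorm' y < r1 + δ → ‖y.1‖ < r1 / 4 →
        ∃ L : ℝ,
          Filter.Tendsto (pvInt2Tr d α (hfun d r1 α) y)
            (nhdsWithin 0 (Set.Ioi 0)) (nhds L) ∧
          |fracConst d α * L| ≤
            C * |Real.log (y.2 - Real.sqrt (r1 ^ 2 - ‖y.1‖ ^ 2))| := by
  obtain ⟨hα0, hα2⟩ := hα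
  obtain ⟨hr0, hr2⟩ := hr1
  have hd0 : (0 : ℝ) < d := by exact_mod_cast hd
  obtain ⟨K, hK⟩ : ∃ K : ℝ, K = d * (volume : Measure (EuclideanSpace ℝ (Fin (d - 1)) × ℝ)).real
    (Metric.ball 0 1) := ⟨_, rfl⟩
  have hK0 : 0 ≤ K := by rw [hK]; positivity
  have hα2' : 0 < 2 - α := by linarith
  refine ⟨r1 / 4, ⟨by positivity, le_rfl⟩, |fracConst d α| * (K * (76 / (2 - α) + 144)) + 1,
    by positivity, ?_⟩
  intro y hy2 hyr hyN hy1
  set s := y.2 - √(r1 ^ 2 - ‖y.1‖ ^ 2) with hs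
  have hs0 : 0 < s := sub_pos.2 (sqrt_lt_snd_of_lt_enorm' hr0 hyr hy2)
  have hsr : s ≤ r1 / 2 := by
    have h1 := (le_abs_self _).trans (abs_snd_le_enorm' y)
    have h2 : 3 / 4 * r1 ≤ √(r1 ^ 2 - ‖y.1‖ ^ 2) := by
      apply Real.le_sqrt_of_sq_le
      nlinarith [norm_nonneg y.1]
    linarith
  have hB := integrable_hfunMajorant (d := d) hd hα2 hs0 (by linarith)
  obtain ⟨L, hL, hLB⟩ := exists_tendsto_pvInt2Tr (M := 1) y (by linarith)
    (measurable_hfun (r := r1) (p := α))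
    (fun z => abs_le.2 ⟨by linarith [hfun_nonneg (p := α) hr0 z], hfun_le_one hr0 hr2 hα0 z⟩)
    hB.1 (hfunMajorant_nonneg hs0.le)
    (fun w h0 h1 => hfun_second_diff_div_le hr0 hr2 hα0 hα2 hy1 hyN hs hs0 hsr h0 h1)
  refine ⟨L, hL, ?_⟩
  rw [hB.2, ← hK] at hLB
  have hlog : Real.log s ≤ -Real.log 2 := by
    rw [← Real.log_inv]
    exact Real.log_le_log hs0 (by linarith)
  have hl2 : 1 / 2 ≤ Real.log 2 := by linarith [Real.log_two_gt_d9]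
  have hlog8 : Real.log (8 / s) ≤ 4 * |Real.log s| := by
    rw [Real.log_div (by norm_num) hs0.ne', abs_of_neg (by linarith),
      show (8 : ℝ) = 2 ^ 3 by norm_num, Real.log_pow]
    push_cast
    linarith
  have hone : 1 ≤ 2 * |Real.log s| := by
    rw [abs_of_neg (by linarith)]
    linarith
  have hLs : |L| ≤ K * (76 / (2 - α) + 144) * |Real.log s| := by
    refine hLB.trans ?_
    rw [mul_assoc K (_ + _)]
    refine mul_le_mul_of_nonneg_left ?_ hK0
    have h1 := mul_le_mul_of_nonneg_left hone (by positivity : 0 ≤ 38 / (2 - α))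
    have h2 : 38 / (2 - α) * (2 * |Real.log s|) = 76 / (2 - α) * |Real.log s| := by ring
    linarith
  rw [abs_mul]
  calc |fracConst d α| * |L|
      ≤ |fracConst d α| * (K * (76 / (2 - α) + 144) * |Real.log s|) := by gcongr
    _ ≤ (|fracConst d α| * (K * (76 / (2 - α) + 144)) + 1) * |Real.log s| := by
      nlinarith [abs_nonneg (Real.log s)]
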